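/- Let a ∈ [2,3). There exists ε > 0 with the following property. Let û and v̂ be Fourier-side mild solutions of the Navier–Stokes system with data (û₀, F̂) and (v̂₀, F̂) respectively (the same external force), each satisfying sup_{t≥0} ess sup_ξ |ξ|² |û(ξ,t)| ≤ 2ε and sup_{t≥0} ess sup_ξ |ξ|² |v̂(ξ,t)| ≤ 2ε. If ess sup_ξ |ξ|² |û₀(ξ) − v̂₀(ξ)| < ε, then sup_{t>0} t^{a/2−1} ess sup_ξ |ξ|^a |û(ξ,t) − v̂(ξ,t)| < ∞; that is, the difference of the two (possibly singular) solutions is more regular than each solution separately, lying in PM^a with the weighted bound for every a < 3. -/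

import Mathlib

open MeasureTheory Filter
open scoped ENNReal

noncomputable section

abbrev E3 : Type := EuclideanSpace ℝ (Fin 3)
abbrev V3 : Type := Fin 3 → ℂ

/-- The `PM^a` norm (on the Fourier side): `ess sup_ξ |ξ|^a |g(ξ)|`, valued in `ℝ≥0∞`. -/
def PMnorm (a : ℝ) (g : E3 → V3) : ℝ≥0∞ :=
  essSup (fun ξ : E3 => ENNReal.ofReal (‖ξ‖ ^ a * ‖g ξ‖)) volume

/-- The symbol `P̂(ξ)_{jk} = δ_{jk} − ξ_j ξ_k / |ξ|²` of the Leray projector. -/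
def LerayP (ξ : E3) : Matrix (Fin 3) (Fin 3) ℂ :=
  fun j k => (if j = k then (1 : ℂ) else 0) - ((ξ j : ℂ) * (ξ k : ℂ)) / ((‖ξ‖ : ℂ) ^ 2)

/-- The matrix-valued convolution
`Ŵ[v,w](ξ)_{jk} = (2π)^{-3/2} ∫ v_j(ξ−z) w_k(z) dz`
(the Fourier transform of the tensor product `v ⊗ w`). -/
def Wconv (v w : E3 → V3) (ξ : E3) : Matrix (Fin 3) (Fin 3) ℂ :=
  fun j k => (((2 * Real.pi) ^ ((3 : ℝ) / 2))⁻¹ : ℝ) • ∫ z : E3, v (ξ - z) j * w z k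

/-- The vector `iξ·Ŵ[v,w](ξ)`, with components `Σ_k iξ_k Ŵ[v,w](ξ)_{jk}`. -/
def ixW (v w : E3 → V3) (ξ : E3) : V3 :=
  fun j => ∑ k : Fin 3, Complex.I * (ξ k : ℂ) * Wconv v w ξ j k

/-- The Fourier side of the Navier–Stokes bilinear Duhamel term
`B(u,v)(t) = −∫₀ᵗ S(t−τ) P ∇·(u⊗v) dτ` (up to sign):
`∫₀ᵗ e^{−(t−τ)|ξ|²} P̂(ξ)( iξ·Ŵ[û(τ),v̂(τ)](ξ) ) dτ`. -/
def Bterm (u v : E3 → ℝ → V3) (ξ : E3) (t : ℝ) : V3 :=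
  ∫ τ in (0 : ℝ)..t, Real.exp (-(t - τ) * ‖ξ‖ ^ 2) •
    (LerayP ξ).mulVec (ixW (fun ζ => u ζ τ) (fun ζ => v ζ τ) ξ)

/-- The Fourier side of the Duhamel force term `∫₀ᵗ S(t−τ) P F(τ) dτ`. -/
def Fterm (F : E3 → ℝ → V3) (ξ : E3) (t : ℝ) : V3 :=
  ∫ τ in (0 : ℝ)..t, Real.exp (-(t - τ) * ‖ξ‖ ^ 2) • (LerayP ξ).mulVec (F ξ τ)

/-- `sup_{t ≥ 0} ‖u(t)‖_{PM^a}`. -/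
def supPM (a : ℝ) (u : E3 → ℝ → V3) : ℝ≥0∞ :=
  ⨆ (t : ℝ) (_ : 0 ≤ t), PMnorm a (fun ξ => u ξ t)

/-- A Fourier-side mild solution of the Navier–Stokes system with data `(û₀, F̂)`:
`û` is jointly measurable, all integrals converge absolutely, and for every `t ≥ 0`
and a.e. `ξ`,
`û(ξ,t) = e^{−t|ξ|²} û₀(ξ) − ∫₀ᵗ e^{−(t−τ)|ξ|²} P̂(ξ)(iξ·Ŵ[û(τ),û(τ)](ξ)) dτ
 + ∫₀ᵗ e^{−(t−τ)|ξ|²} P̂(ξ) F̂(ξ,τ) dτ`. -/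
def IsMildSolution (u0 : E3 → V3) (F : E3 → ℝ → V3) (u : E3 → ℝ → V3) : Prop :=
  Measurable (fun p : E3 × ℝ => u p.1 p.2) ∧
  ∀ t : ℝ, 0 ≤ t → ∀ᵐ ξ : E3,
    (∀ τ ∈ Set.Icc (0 : ℝ) t, ∀ j k : Fin 3,
        Integrable (fun z : E3 => u (ξ - z) τ j * u z τ k)) ∧
    IntervalIntegrable (fun τ : ℝ =>
        Real.exp (-(t - τ) * ‖ξ‖ ^ 2) •
          (LerayP ξ).mulVec (ixW (fun ζ => u ζ τ) (fun ζ => u ζ τ) ξ)) volume 0 t ∧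
    IntervalIntegrable (fun τ : ℝ =>
        Real.exp (-(t - τ) * ‖ξ‖ ^ 2) • (LerayP ξ).mulVec (F ξ τ)) volume 0 t ∧
    u ξ t = Real.exp (-t * ‖ξ‖ ^ 2) • u0 ξ - Bterm u u ξ t + Fterm F ξ t

/-- `η` is a constant for which the `PM²` bilinear estimate holds:
`‖B(u,v)(t)‖_{PM²} ≤ η (sup_τ ‖u(τ)‖_{PM²})(sup_τ ‖v(τ)‖_{PM²})`. -/
def BilinearEstimate (η : ℝ) : Prop :=
  ∀ u v : E3 → ℝ → V3,
    Measurable (fun p : E3 × ℝ => u p.1 p.2) →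
    Measurable (fun p : E3 × ℝ => v p.1 p.2) →
    ∀ t : ℝ, 0 ≤ t →
      PMnorm 2 (fun ξ => Bterm u v ξ t) ≤ ENNReal.ofReal η * supPM 2 u * supPM 2 v

/-- The weighted norm `|||v|||_a = sup_{t>0} t^{a/2−1} ‖v(t)‖_{PM^a}`. -/
def wsupPM (a : ℝ) (u : E3 → ℝ → V3) : ℝ≥0∞ :=
  ⨆ (t : ℝ) (_ : 0 < t), ENNReal.ofReal (t ^ (a / 2 - 1)) * PMnorm a (fun ξ => u ξ t)


lemma phi_integrable (b : ℝ) (hb : b < 3) :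
    Integrable (fun z : E3 => (Set.Ioo (0:ℝ) 1).indicator (fun r => r ^ (-b)) ‖z‖) := by
  rw [integrable_fun_norm_addHaar (volume : Measure E3)
    (f := (Set.Ioo (0:ℝ) 1).indicator (fun r => r ^ (-b)))]
  have h1 : IntegrableOn (fun x : ℝ => x ^ (2 - b)) (Set.Ioo 0 1) volume :=
    (intervalIntegral.integrableOn_Ioo_rpow_iff one_pos).2 (by linarith)
  have h2 : Integrable ((Set.Ioo (0:ℝ) 1).indicator (fun x : ℝ => x ^ (2 - b))) :=
    (integrable_indicator_iff measurableSet_Ioo).2 h1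
  refine (h2.integrableOn).congr_fun ?_ measurableSet_Ioi
  intro x hx
  have hx : 0 < x := hx
  by_cases h : x ∈ Set.Ioo (0:ℝ) 1
  · simp only [Set.indicator_of_mem h, finrank_euclideanSpace, Fintype.card_fin, smul_eq_mul]
    rw [sub_eq_add_neg, Real.rpow_add hx]
    norm_num
  · simp [Set.indicator_of_notMem h]

lemma ker_unit (b : ℝ) (hb2 : 2 ≤ b) (hb : b < 3) :
    ∃ K : ℝ, 0 < K ∧ ∀ e : E3, ‖e‖ = 1 →
      Integrable (fun z : E3 => ‖e - z‖ ^ (-2:ℝ) * ‖z‖ ^ (-b)) ∧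
      ∫ z : E3, ‖e - z‖ ^ (-2:ℝ) * ‖z‖ ^ (-b) ≤ K := by
  set φ : ℝ → E3 → ℝ := fun b z => (Set.Ioo (0:ℝ) 1).indicator (fun r => r ^ (-b)) ‖z‖ with hφ
  have hφ0 : ∀ b z, 0 ≤ φ b z := fun b z =>
    Set.indicator_nonneg (fun r hr => Real.rpow_nonneg hr.1.le _) _
  have hφi : ∀ b < 3, Integrable (φ b) := fun b hb => phi_integrable b hb
  have hφv : ∀ b z, 0 < ‖z‖ → ‖z‖ ≤ 1/2 → φ b z = ‖z‖ ^ (-b) := fun b z h h' =>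
    Set.indicator_of_mem (s := Set.Ioo (0:ℝ) 1) ⟨h, by linarith⟩ _
  set ψ : E3 → ℝ := fun z => (1 + ‖z‖) ^ (-(2 + b)) with hψ
  have hψi : Integrable ψ := integrable_one_add_norm (by simp; linarith)
  have hψ0 : ∀ z, 0 ≤ ψ z := fun z => by positivity
  have hpow : ∀ {x y c : ℝ}, 0 < x → x ≤ y → 0 ≤ c → y ^ (-c) ≤ x ^ (-c) := by
    intro x y c hx hxy hc
    exact Real.rpow_le_rpow_of_nonpos hx hxy (by linarith)
  have bound : ∀ e : E3, ‖e‖ = 1 → ∀ z : E3, ‖e - z‖ ^ (-2:ℝ) * ‖z‖ ^ (-b) ≤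
      4 * φ b z + 8 * φ 2 (e - z) + 2187 * ψ z := by
    intro e he z
    have t1 : ‖e‖ ≤ ‖e - z‖ + ‖z‖ := by simpa using norm_add_le (e - z) z
    have t2 : ‖z‖ ≤ ‖e‖ + ‖e - z‖ := by
      simpa [norm_sub_rev] using norm_add_le e (z - e)
    have p1 := hφ0 b z
    have p2 := hφ0 2 (e - z)
    have p3 := hψ0 z
    rw [he] at t1 t2
    rcases (norm_nonneg z).eq_or_lt with h0 | h0
    · rw [← h0, Real.zero_rpow (by linarith)]; nlinarith
    rcases (norm_nonneg (e - z)).eq_or_lt with h0' | h0'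
    · rw [← h0', Real.zero_rpow (by norm_num)]; nlinarith
    by_cases c1 : ‖z‖ ≤ 1/2
    · rw [hφv b z h0 c1] at p1 ⊢
      have : ‖e - z‖ ^ (-2:ℝ) ≤ 4 := by
        refine (hpow (x := 1/2) (by norm_num) (by linarith) (by norm_num)).trans ?_
        rw [Real.rpow_neg (by norm_num)]; norm_num
      nlinarith
    by_cases c2 : ‖e - z‖ ≤ 1/2
    · rw [hφv 2 _ h0' c2] at p2 ⊢
      have : ‖z‖ ^ (-b) ≤ 8 := by
        refine (hpow (x := 1/2) (by norm_num) (by linarith) (by linarith)).trans ?_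
        rw [one_div, Real.inv_rpow (by norm_num), Real.rpow_neg (by norm_num), inv_inv]
        calc (2:ℝ) ^ b ≤ 2 ^ (3:ℝ) := Real.rpow_le_rpow_of_exponent_le (by norm_num) hb.le
          _ = 8 := by norm_num
      nlinarith
    push Not at c1 c2
    have e1 : ‖e - z‖ ^ (-2:ℝ) ≤ 81 * (1 + ‖z‖) ^ (-2:ℝ) := by
      refine (hpow (x := (1 + ‖z‖) / 9) (by positivity) (by linarith) (by norm_num)).trans ?_
      rw [Real.div_rpow (by positivity) (by norm_num), Real.rpow_neg (x := 9) (by norm_num)]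
      norm_num
      linarith
    have e2 : ‖z‖ ^ (-b) ≤ 27 * (1 + ‖z‖) ^ (-b) := by
      refine (hpow (x := (1 + ‖z‖) / 3) (by positivity) (by linarith) (by linarith)).trans ?_
      rw [Real.div_rpow (by positivity) (by norm_num), Real.rpow_neg (x := 3) (by norm_num),
        div_inv_eq_mul, mul_comm]
      gcongr
      calc (3:ℝ) ^ b ≤ 3 ^ (3:ℝ) := Real.rpow_le_rpow_of_exponent_le (by norm_num) hb.le
          _ = 27 := by norm_num
    have e3 : ψ z = (1 + ‖z‖) ^ (-2:ℝ) * (1 + ‖z‖) ^ (-b) := by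
      rw [← Real.rpow_add (by positivity)]; simp only [hψ]; congr 1; ring
    calc _ ≤ (81 * (1 + ‖z‖) ^ (-2:ℝ)) * (27 * (1 + ‖z‖) ^ (-b)) := by gcongr
      _ = 2187 * ψ z := by rw [e3]; ring
      _ ≤ _ := by linarith
  refine ⟨4 * (∫ z, φ b z) + 8 * (∫ z, φ 2 z) + 2187 * (∫ z, ψ z) + 1, ?_, ?_⟩
  · have := integral_nonneg (μ := volume) (f := φ b) (hφ0 b)
    have := integral_nonneg (μ := volume) (f := φ 2) (hφ0 2)
    have := integral_nonneg (μ := volume) (f := ψ) hψ0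
    linarith
  intro e he
  have i1 : Integrable (fun z => 4 * φ b z) := (hφi b hb).const_mul 4
  have i2 : Integrable (fun z => 8 * φ 2 (e - z)) :=
    ((hφi 2 (by norm_num)).comp_sub_left e).const_mul 8
  have i3 : Integrable (fun z => 2187 * ψ z) := hψi.const_mul _
  have i12 : Integrable (fun z => 4 * φ b z + 8 * φ 2 (e - z)) := i1.add i2
  have i : Integrable (fun z => 4 * φ b z + 8 * φ 2 (e - z) + 2187 * ψ z) := i12.add i3
  have ig : Integrable (fun z : E3 => ‖e - z‖ ^ (-2:ℝ) * ‖z‖ ^ (-b)) := by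
    refine i.mono' (by fun_prop) (.of_forall fun z => ?_)
    rw [Real.norm_of_nonneg (by positivity)]
    exact bound e he z
  refine ⟨ig, (integral_mono ig i (bound e he)).trans ?_⟩
  rw [integral_add i12 i3, integral_add i1 i2, integral_const_mul, integral_const_mul,
    integral_const_mul, integral_sub_left_eq_self (φ 2) volume e]
  linarith

lemma ker_bound (b : ℝ) (hb2 : 2 ≤ b) (hb : b < 3) :
    ∃ K : ℝ, 0 < K ∧ ∀ ξ : E3, ξ ≠ 0 →
      Integrable (fun z : E3 => ‖ξ - z‖ ^ (-2:ℝ) * ‖z‖ ^ (-b)) ∧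
      ∫ z : E3, ‖ξ - z‖ ^ (-2:ℝ) * ‖z‖ ^ (-b) ≤ K * ‖ξ‖ ^ (1 - b) := by
  obtain ⟨K, hK, h⟩ := ker_unit b hb2 hb
  refine ⟨K, hK, fun ξ hξ => ?_⟩
  have hr : 0 < ‖ξ‖ := norm_pos_iff.2 hξ
  obtain ⟨h1, h2⟩ := h (‖ξ‖⁻¹ • ξ) (by
    rw [norm_smul, norm_inv, norm_norm, inv_mul_cancel₀ hr.ne'])
  have key : (fun z : E3 => ‖ξ - z‖ ^ (-2:ℝ) * ‖z‖ ^ (-b)) = fun z =>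
      ‖ξ‖ ^ (-2 - b) * (fun z : E3 => ‖‖ξ‖⁻¹ • ξ - z‖ ^ (-2:ℝ) * ‖z‖ ^ (-b)) (‖ξ‖⁻¹ • z) := by
    funext z
    simp only [← smul_sub, norm_smul, norm_inv, norm_norm]
    rw [Real.mul_rpow (by positivity) (by positivity), Real.mul_rpow (by positivity) (by positivity),
      Real.inv_rpow hr.le, Real.inv_rpow hr.le, show -2 - b = -2 + -b by ring, Real.rpow_add hr]
    have := Real.rpow_pos_of_pos hr (-2)
    have := Real.rpow_pos_of_pos hr (-b)
    field_simp
  rw [key]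
  refine ⟨(h1.comp_smul (inv_ne_zero hr.ne')).const_mul _, ?_⟩
  rw [integral_const_mul, Measure.integral_comp_smul volume
    (fun z : E3 => ‖‖ξ‖⁻¹ • ξ - z‖ ^ (-2:ℝ) * ‖z‖ ^ (-b))]
  have e : |((‖ξ‖⁻¹) ^ Module.finrank ℝ E3)⁻¹| = ‖ξ‖ ^ (3:ℝ) := by
    rw [abs_of_nonneg (by positivity)]; simp
  rw [e, smul_eq_mul, ← mul_assoc, ← Real.rpow_add hr, mul_comm]
  rw [show -2 - b + 3 = 1 - b by ring]
  gcongr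

lemma time_bound (b s t : ℝ) (hb0 : 0 ≤ b) (hb : b ≤ 1/2) (hs : 0 < s) (ht : 0 < t) :
    IntervalIntegrable (fun τ => Real.exp (-(t - τ) * s) * τ ^ (-b)) volume 0 t ∧
    ∫ τ in (0:ℝ)..t, Real.exp (-(t - τ) * s) * τ ^ (-b) ≤ 6 * s⁻¹ * t ^ (-b) := by
  have i1 : IntervalIntegrable (fun τ : ℝ => τ ^ (-b)) volume 0 t :=
    intervalIntegral.intervalIntegrable_rpow' (by linarith)
  have c : Continuous (fun τ => Real.exp (-(t - τ) * s)) := by fun_prop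
  have i0 : IntervalIntegrable (fun τ => Real.exp (-(t - τ) * s) * τ ^ (-b)) volume 0 t :=
    i1.continuousOn_mul c.continuousOn
  refine ⟨i0, ?_⟩
  have i2 : IntervalIntegrable (fun τ : ℝ => 2 * t ^ (-b) * Real.exp (-(t - τ) * s)) volume 0 t :=
    (c.intervalIntegrable _ _).const_mul _
  have i3 : IntervalIntegrable (fun τ : ℝ => Real.exp (- (t * s / 2)) * τ ^ (-b)) volume 0 t :=
    i1.const_mul _
  have hpt : ∀ τ ∈ Set.Ioo 0 t, Real.exp (-(t - τ) * s) * τ ^ (-b) ≤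
      2 * t ^ (-b) * Real.exp (-(t - τ) * s) + Real.exp (- (t * s / 2)) * τ ^ (-b) := by
    intro τ hτ
    have q1 : 0 < τ ^ (-b) := Real.rpow_pos_of_pos hτ.1 _
    have q2 : 0 < t ^ (-b) := Real.rpow_pos_of_pos ht _
    have q3 := Real.exp_pos (-(t - τ) * s)
    have q4 := Real.exp_pos (- (t * s / 2))
    rcases le_total τ (t/2) with h | h
    · have : Real.exp (-(t - τ) * s) ≤ Real.exp (- (t * s / 2)) := by
        apply Real.exp_le_exp.2; nlinarith
      have := mul_le_mul_of_nonneg_right this q1.le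
      have : 0 < 2 * t ^ (-b) * Real.exp (-(t - τ) * s) := by positivity
      linarith
    · have : τ ^ (-b) ≤ 2 * t ^ (-b) := by
        refine (Real.rpow_le_rpow_of_nonpos (by positivity) h (by linarith)).trans ?_
        rw [Real.div_rpow ht.le (by norm_num), Real.rpow_neg (x := 2) (by norm_num),
          div_inv_eq_mul, mul_comm]
        gcongr
        calc (2:ℝ) ^ b ≤ 2 ^ (1:ℝ) :=
              Real.rpow_le_rpow_of_exponent_le (by norm_num) (by linarith)
          _ = 2 := by norm_num
      have := mul_le_mul_of_nonneg_left this q3.le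
      have : 0 < Real.exp (- (t * s / 2)) * τ ^ (-b) := by positivity
      linarith
  have hE : ∫ τ in (0:ℝ)..t, Real.exp (-(t - τ) * s) ≤ s⁻¹ := by
    have := intervalIntegral.integral_eq_sub_of_hasDerivAt (a := 0) (b := t)
      (f := fun τ => s⁻¹ * Real.exp (-(t - τ) * s)) (f' := fun τ => Real.exp (-(t - τ) * s))
      (fun x _ => by
        have h : HasDerivAt (fun τ => s⁻¹ * Real.exp (-(t - τ) * s))
            (s⁻¹ * (Real.exp (-(t - x) * s) * (-(-1) * s))) x :=
          ((((hasDerivAt_id' x).const_sub t).neg.mul_const s).exp).const_mul s⁻¹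
        have e : s⁻¹ * (Real.exp (-(t - x) * s) * (-(-1) * s)) = Real.exp (-(t - x) * s) := by
          rw [neg_neg, one_mul, mul_comm, mul_assoc, mul_inv_cancel₀ hs.ne', mul_one]
        rwa [e] at h) (c.intervalIntegrable _ _)
    rw [this]
    have : 0 < s⁻¹ * Real.exp (-(t - 0) * s) := by positivity
    simp only [sub_self, neg_zero, zero_mul, Real.exp_zero, mul_one]
    linarith
  have hR : ∫ τ in (0:ℝ)..t, τ ^ (-b) ≤ 2 * (t * t ^ (-b)) := by
    rw [integral_rpow (Or.inl (by linarith)), Real.zero_rpow (by linarith), sub_zero,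
      Real.rpow_add ht, Real.rpow_one, mul_comm, div_le_iff₀ (by linarith)]
    have : 0 < t * t ^ (-b) := by positivity
    nlinarith
  have hx : Real.exp (- (t * s / 2)) ≤ 2 / (t * s) := by
    rw [Real.exp_neg, show 2 / (t * s) = (t * s / 2)⁻¹ by field_simp]
    apply inv_anti₀ (by positivity)
    linarith [Real.add_one_le_exp (t * s / 2)]
  calc _ ≤ ∫ τ in (0:ℝ)..t, (2 * t ^ (-b) * Real.exp (-(t - τ) * s) +
        Real.exp (- (t * s / 2)) * τ ^ (-b)) :=
        intervalIntegral.integral_mono_on_of_le_Ioo ht.le i0 (i2.add i3) hpt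
    _ = 2 * t ^ (-b) * (∫ τ in (0:ℝ)..t, Real.exp (-(t - τ) * s)) +
        Real.exp (- (t * s / 2)) * ∫ τ in (0:ℝ)..t, τ ^ (-b) := by
        rw [intervalIntegral.integral_add i2 i3, intervalIntegral.integral_const_mul,
          intervalIntegral.integral_const_mul]
    _ ≤ 2 * t ^ (-b) * s⁻¹ + 2 / (t * s) * (2 * (t * t ^ (-b))) := by
        have : 0 ≤ ∫ τ in (0:ℝ)..t, τ ^ (-b) :=
          intervalIntegral.integral_nonneg ht.le fun x hx => Real.rpow_nonneg hx.1 _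
        gcongr
    _ = _ := by field_simp; ring

lemma leray_bound (ξ : E3) (w : V3) (M : ℝ) (hM : 0 ≤ M) (hw : ∀ k, ‖w k‖ ≤ M) :
    ‖(LerayP ξ).mulVec w‖ ≤ 6 * M := by
  have hL : ∀ j k, ‖LerayP ξ j k‖ ≤ 2 := by
    intro j k
    have h1 : ‖(if j = k then (1 : ℂ) else 0)‖ ≤ 1 := by split_ifs <;> simp
    have h2 : ‖((ξ j : ℂ) * (ξ k : ℂ)) / ((‖ξ‖ : ℂ) ^ 2)‖ ≤ 1 := by
      have a1 : |ξ j| ≤ ‖ξ‖ := PiLp.norm_apply_le ξ j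
      have a2 : |ξ k| ≤ ‖ξ‖ := PiLp.norm_apply_le ξ k
      rw [norm_div, norm_mul, norm_pow, Complex.norm_real, Complex.norm_real, Complex.norm_real,
        norm_norm, Real.norm_eq_abs, Real.norm_eq_abs, sq]
      apply div_le_one_of_le₀ _ (by positivity)
      gcongr
    exact (norm_sub_le _ _).trans (by linarith)
  rw [pi_norm_le_iff_of_nonneg (by positivity)]
  intro j
  simp only [Matrix.mulVec, dotProduct]
  refine (norm_sum_le _ _).trans ?_
  calc ∑ k, ‖LerayP ξ j k * w k‖ ≤ ∑ k : Fin 3, 2 * M := by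
        apply Finset.sum_le_sum; intro k _
        rw [norm_mul]
        exact mul_le_mul (hL j k) (hw k) (norm_nonneg _) (by norm_num)
    _ = 6 * M := by simp; ring

lemma const_le_one : ((2 * Real.pi) ^ ((3 : ℝ) / 2))⁻¹ ≤ 1 := by
  apply inv_le_one_of_one_le₀
  apply Real.one_le_rpow _ (by norm_num)
  linarith [Real.two_le_pi]

lemma nonlin_bound (ξ : E3) (U V : E3 → V3) (I : ℝ) (hI : 0 ≤ I)
    (h : ∀ j k, ‖(∫ z : E3, U (ξ - z) j * U z k) - ∫ z : E3, V (ξ - z) j * V z k‖ ≤ I) :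
    ‖(LerayP ξ).mulVec (ixW U U ξ) - (LerayP ξ).mulVec (ixW V V ξ)‖ ≤ 18 * (‖ξ‖ * I) := by
  rw [← Matrix.mulVec_sub]
  have : ∀ j, ‖(ixW U U ξ - ixW V V ξ) j‖ ≤ 3 * (‖ξ‖ * I) := by
    intro j
    simp only [Pi.sub_apply, ixW, Wconv]
    rw [← Finset.sum_sub_distrib]
    refine (norm_sum_le _ _).trans ?_
    calc _ ≤ ∑ k : Fin 3, ‖ξ‖ * I := by
          apply Finset.sum_le_sum; intro k _
          rw [← mul_sub, ← smul_sub, norm_mul, norm_mul, norm_smul, Complex.norm_I, one_mul,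
            Complex.norm_real]
          have c0 : (0:ℝ) ≤ ((2 * Real.pi) ^ ((3 : ℝ) / 2))⁻¹ := by positivity
          rw [Real.norm_of_nonneg c0]
          have := PiLp.norm_apply_le ξ k
          have h2 := mul_le_mul const_le_one (h j k) (norm_nonneg _) zero_le_one
          rw [one_mul] at h2
          gcongr
      _ = _ := by simp
  refine (leray_bound ξ _ _ (by positivity) this).trans (by linarith)

lemma conv_bound (K2 Ka a : ℝ) (ξ : E3)
    (h2 : Integrable (fun z : E3 => ‖ξ - z‖ ^ (-2:ℝ) * ‖z‖ ^ (-2:ℝ)) ∧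
      ∫ z : E3, ‖ξ - z‖ ^ (-2:ℝ) * ‖z‖ ^ (-2:ℝ) ≤ K2)
    (h3 : Integrable (fun z : E3 => ‖ξ - z‖ ^ (-2:ℝ) * ‖z‖ ^ (-a)) ∧
      ∫ z : E3, ‖ξ - z‖ ^ (-2:ℝ) * ‖z‖ ^ (-a) ≤ Ka)
    (U V : E3 → V3) (m A δ : ℝ) (hm : 0 ≤ m) (hA : 0 ≤ A) (hδ : 0 ≤ δ)
    (hU : ∀ᵐ z : E3, ‖U z‖ ≤ m * ‖z‖ ^ (-2:ℝ))
    (hV : ∀ᵐ z : E3, ‖V z‖ ≤ m * ‖z‖ ^ (-2:ℝ))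
    (hZ : ∀ᵐ z : E3, ‖U z - V z‖ ≤ A * ‖z‖ ^ (-a) + δ * ‖z‖ ^ (-2:ℝ))
    (iU : ∀ j k, Integrable (fun z : E3 => U (ξ - z) j * U z k))
    (iV : ∀ j k, Integrable (fun z : E3 => V (ξ - z) j * V z k)) (j k : Fin 3) :
    ‖(∫ z : E3, U (ξ - z) j * U z k) - ∫ z : E3, V (ξ - z) j * V z k‖ ≤
      2 * m * (A * Ka + δ * K2) := by
  rw [← integral_sub (iU j k) (iV j k)]
  set f : E3 → ℝ := fun z => m * (A * (‖ξ - z‖ ^ (-2:ℝ) * ‖z‖ ^ (-a)) +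
    δ * (‖ξ - z‖ ^ (-2:ℝ) * ‖z‖ ^ (-2:ℝ))) with hf
  have i1 := h3.1.const_mul A
  have i2 := h2.1.const_mul δ
  have fi : Integrable f := (i1.add i2).const_mul m
  have fI : ∫ z, f z ≤ m * (A * Ka + δ * K2) := by
    simp only [hf]
    rw [integral_const_mul, integral_add i1 i2, integral_const_mul, integral_const_mul]
    have := h2.2
    have := h3.2
    gcongr
  have fi' := fi.comp_sub_left ξ
  have qm : MeasurePreserving (fun z : E3 => ξ - z) volume volume :=
    Measure.measurePreserving_sub_left volume ξ
  have hU' := qm.quasiMeasurePreserving.ae hU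
  have hZ' := qm.quasiMeasurePreserving.ae hZ
  refine (norm_integral_le_of_norm_le (fi.add fi') ?_).trans ?_
  · filter_upwards [hU', hZ', hV, hZ] with z u z' v w
    have e : U (ξ - z) j * U z k - V (ξ - z) j * V z k =
      U (ξ - z) j * (U z - V z) k + (U (ξ - z) - V (ξ - z)) j * V z k := by
      simp only [Pi.sub_apply]; ring
    rw [e]
    refine (norm_add_le _ _).trans ?_
    rw [norm_mul, norm_mul]
    have n1 := (norm_le_pi_norm (U (ξ - z)) j).trans u
    have n2 := (norm_le_pi_norm (U z - V z) k).trans w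
    have n3 := (norm_le_pi_norm (U (ξ - z) - V (ξ - z)) j).trans z'
    have n4 := (norm_le_pi_norm (V z) k).trans v
    have b1 := mul_le_mul n1 n2 (norm_nonneg _) (by positivity)
    have b2 := mul_le_mul n3 n4 (norm_nonneg _) (by positivity)
    refine (add_le_add b1 b2).trans (le_of_eq ?_)
    simp only [hf, Pi.add_apply, sub_sub_cancel]
    ring
  · simp only [Pi.add_apply]
    rw [integral_add fi fi', integral_sub_left_eq_self f volume ξ]
    linarith

lemma exp_bound (b s : ℝ) (hb0 : 0 ≤ b) (hb : b ≤ 1) (hs : 0 < s) :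
    Real.exp (-s) ≤ s ^ (-b) := by
  rw [Real.exp_neg, Real.rpow_neg hs.le]
  apply inv_anti₀ (Real.rpow_pos_of_pos hs _)
  rcases le_total s 1 with h | h
  · exact (Real.rpow_le_one hs.le h hb0).trans (Real.one_le_exp hs.le)
  · calc s ^ b ≤ s ^ (1:ℝ) := Real.rpow_le_rpow_of_exponent_le h hb
      _ ≤ _ := by rw [Real.rpow_one]; linarith [Real.add_one_le_exp s]

lemma ae_ne_zero : ∀ᵐ ξ : E3, ξ ≠ 0 := by
  simp [ae_iff]

lemma pm_ae (a c : ℝ) (hc : 0 ≤ c) (g : E3 → V3) (h : PMnorm a g ≤ ENNReal.ofReal c) :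
    ∀ᵐ ξ : E3, ‖g ξ‖ ≤ c * ‖ξ‖ ^ (-a) := by
  filter_upwards [ENNReal.ae_le_essSup (μ := volume)
    (fun ξ : E3 => ENNReal.ofReal (‖ξ‖ ^ a * ‖g ξ‖)), ae_ne_zero] with ξ h1 h2
  have h3 := (ENNReal.ofReal_le_ofReal_iff hc).1 (h1.trans h)
  have : 0 < ‖ξ‖ := norm_pos_iff.2 h2
  rw [Real.rpow_neg this.le, ← div_eq_mul_inv, le_div_iff₀ (by positivity), mul_comm]
  exact h3

lemma ae_pm (a c : ℝ) (g : E3 → V3) (h : ∀ᵐ ξ : E3, ‖g ξ‖ ≤ c * ‖ξ‖ ^ (-a)) :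
    PMnorm a g ≤ ENNReal.ofReal c := by
  refine essSup_le_of_ae_le _ ?_
  filter_upwards [h, ae_ne_zero] with ξ h1 h2
  apply ENNReal.ofReal_le_ofReal
  have : 0 < ‖ξ‖ := norm_pos_iff.2 h2
  rwa [Real.rpow_neg this.le, ← div_eq_mul_inv, le_div_iff₀ (by positivity), mul_comm] at h1

lemma step (a K ε δ : ℝ) (ha : 2 ≤ a) (ha' : a < 3) (hK : 0 < K) (hε : 0 < ε) (hδ : 0 ≤ δ)
    (hεK : 864 * (ε * K) ≤ 1)
    (h2 : ∀ ξ : E3, ξ ≠ 0 → Integrable (fun z : E3 => ‖ξ - z‖ ^ (-2:ℝ) * ‖z‖ ^ (-2:ℝ)) ∧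
      ∫ z : E3, ‖ξ - z‖ ^ (-2:ℝ) * ‖z‖ ^ (-2:ℝ) ≤ K * ‖ξ‖ ^ (1 - 2 : ℝ))
    (h3 : ∀ ξ : E3, ξ ≠ 0 → Integrable (fun z : E3 => ‖ξ - z‖ ^ (-2:ℝ) * ‖z‖ ^ (-a)) ∧
      ∫ z : E3, ‖ξ - z‖ ^ (-2:ℝ) * ‖z‖ ^ (-a) ≤ K * ‖ξ‖ ^ (1 - a))
    (u0 v0 : E3 → V3) (F : E3 → ℝ → V3) (u v : E3 → ℝ → V3)
    (hu : IsMildSolution u0 F u) (hv : IsMildSolution v0 F v)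
    (bu : ∀ t, 0 ≤ t → ∀ᵐ ξ : E3, ‖u ξ t‖ ≤ 2 * ε * ‖ξ‖ ^ (-2:ℝ))
    (bv : ∀ t, 0 ≤ t → ∀ᵐ ξ : E3, ‖v ξ t‖ ≤ 2 * ε * ‖ξ‖ ^ (-2:ℝ))
    (b0 : ∀ᵐ ξ : E3, ‖u0 ξ - v0 ξ‖ ≤ ε * ‖ξ‖ ^ (-2:ℝ))
    (H : ∀ t, 0 < t → ∀ᵐ ξ : E3, ‖u ξ t - v ξ t‖ ≤
      2 * ε * t ^ (-(a/2-1)) * ‖ξ‖ ^ (-a) + δ * ‖ξ‖ ^ (-2:ℝ)) :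
    ∀ t, 0 < t → ∀ᵐ ξ : E3, ‖u ξ t - v ξ t‖ ≤
      2 * ε * t ^ (-(a/2-1)) * ‖ξ‖ ^ (-a) + (δ/2) * ‖ξ‖ ^ (-2:ℝ) := by
  intro t ht
  filter_upwards [hu.2 t ht.le, hv.2 t ht.le, b0, ae_ne_zero] with ξ ⟨iu, ju, _, eu⟩ ⟨iv, jv, _, ev⟩ z0 hξ
  have hr : 0 < ‖ξ‖ := norm_pos_iff.2 hξ
  have hs : 0 < ‖ξ‖ ^ 2 := by positivity
  set b := a/2 - 1 with hb
  have ez : u ξ t - v ξ t = Real.exp (-t * ‖ξ‖ ^ 2) • (u0 ξ - v0 ξ) - (Bterm u u ξ t - Bterm v v ξ t) := by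
    rw [eu, ev, smul_sub]; abel
  -- linear part
  have hlin : ‖Real.exp (-t * ‖ξ‖ ^ 2) • (u0 ξ - v0 ξ)‖ ≤ ε * t ^ (-b) * ‖ξ‖ ^ (-a) := by
    rw [norm_smul, Real.norm_of_nonneg (Real.exp_pos _).le]
    have := exp_bound b (t * ‖ξ‖ ^ 2) (by linarith) (by linarith) (by positivity)
    rw [← neg_mul, Real.mul_rpow ht.le hs.le] at this
    calc _ ≤ (t ^ (-b) * (‖ξ‖ ^ 2) ^ (-b)) * (ε * ‖ξ‖ ^ (-2:ℝ)) := by gcongr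
      _ = ε * t ^ (-b) * (‖ξ‖ ^ (2 * -b) * ‖ξ‖ ^ (-2:ℝ)) := by
        rw [Real.rpow_mul hr.le]; norm_cast; ring
      _ = _ := by rw [← Real.rpow_add hr]; congr 2; rw [hb]; ring
  -- bilinear part
  have hB : ‖Bterm u u ξ t - Bterm v v ξ t‖ ≤
      (432 * (ε * K)) * (2 * ε * t ^ (-b) * ‖ξ‖ ^ (-a) + δ * ‖ξ‖ ^ (-2:ℝ)) := by
    simp only [Bterm]
    rw [← intervalIntegral.integral_sub ju jv]
    obtain ⟨ta, ta'⟩ := time_bound b (‖ξ‖ ^ 2) t (by linarith) (by linarith) hs ht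
    obtain ⟨tb, tb'⟩ := time_bound 0 (‖ξ‖ ^ 2) t (by linarith) (by linarith) hs ht
    have ja := ta.const_mul (72 * (ε * K) * (2 * ε) * ‖ξ‖ ^ (2 - a))
    have jb := tb.const_mul (72 * (ε * K) * δ)
    refine (intervalIntegral.norm_integral_le_of_norm_le ht.le ?_ (ja.add jb)).trans ?_
    · refine .of_forall fun τ hτ => ?_
      have hc := conv_bound _ _ a ξ (h2 ξ hξ) (h3 ξ hξ) (fun ζ => u ζ τ) (fun ζ => v ζ τ)
        (2 * ε) (2 * ε * τ ^ (-b)) δ (by positivity)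
        (mul_nonneg (by positivity) (Real.rpow_nonneg hτ.1.le _)) hδ (bu τ hτ.1.le) (bv τ hτ.1.le)
        (H τ hτ.1) (iu τ ⟨hτ.1.le, hτ.2⟩) (iv τ ⟨hτ.1.le, hτ.2⟩)
      have hτ0 : 0 ≤ τ ^ (-b) := Real.rpow_nonneg hτ.1.le _
      have hn := nonlin_bound ξ (fun ζ => u ζ τ) (fun ζ => v ζ τ)
        (2 * (2 * ε) * (2 * ε * τ ^ (-b) * (K * ‖ξ‖ ^ (1 - a)) + δ * (K * ‖ξ‖ ^ (1 - 2 : ℝ))))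
        (by positivity) hc
      rw [← smul_sub, norm_smul, Real.norm_of_nonneg (Real.exp_pos _).le]
      refine (mul_le_mul_of_nonneg_left hn (Real.exp_pos _).le).trans (le_of_eq ?_)
      have e1 : ‖ξ‖ ^ (2 - a) = ‖ξ‖ * ‖ξ‖ ^ (1 - a) := by
        rw [show 2 - a = 1 + (1 - a) by ring, Real.rpow_add hr, Real.rpow_one]
      have e2 : ‖ξ‖ ^ (1 - 2 : ℝ) = ‖ξ‖⁻¹ := by
        rw [show (1 - 2 : ℝ) = -1 by norm_num, Real.rpow_neg_one]
      simp only [neg_zero, Real.rpow_zero, e1, e2]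
      field_simp
      ring
    · rw [intervalIntegral.integral_add ja jb, intervalIntegral.integral_const_mul,
        intervalIntegral.integral_const_mul]
      calc _ ≤ (72 * (ε * K) * (2 * ε) * ‖ξ‖ ^ (2 - a)) * (6 * (‖ξ‖ ^ 2)⁻¹ * t ^ (-b)) +
            (72 * (ε * K) * δ) * (6 * (‖ξ‖ ^ 2)⁻¹ * t ^ (-0:ℝ)) := by gcongr
        _ = _ := by
          have e1 : ‖ξ‖ ^ (2 - a) = ‖ξ‖ ^ 2 * ‖ξ‖ ^ (-a) := by
            rw [sub_eq_add_neg, Real.rpow_add hr]; norm_cast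
          have e2 : ‖ξ‖ ^ (-2:ℝ) = (‖ξ‖ ^ 2)⁻¹ := by
            rw [Real.rpow_neg hr.le]; norm_cast
          rw [e1, e2]
          simp only [neg_zero, Real.rpow_zero]
          field_simp
          ring
  rw [ez]
  refine (norm_sub_le _ _).trans ((add_le_add hlin hB).trans ?_)
  have p : 0 ≤ 2 * ε * t ^ (-b) * ‖ξ‖ ^ (-a) + δ * ‖ξ‖ ^ (-2:ℝ) := by positivity
  nlinarith

/-- **Regularity of the difference of two solutions with the same force:** for
every `2 ≤ a < 3` there is `ε > 0` such that if `û, v̂` are mild solutions with the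
same external force `F̂`, both of `PM²`-norm at most `2ε`, and
`‖û₀ − v̂₀‖_{PM²} < ε`, then the difference is more regular than each solution
separately: `sup_{t>0} t^{a/2−1} ‖û(t) − v̂(t)‖_{PM^a} < ∞`. -/
theorem difference_regularity (a : ℝ) (ha : 2 ≤ a) (ha' : a < 3) :
    ∃ ε : ℝ, 0 < ε ∧
      ∀ (u0 v0 : E3 → V3) (F : E3 → ℝ → V3) (u v : E3 → ℝ → V3),
        IsMildSolution u0 F u → IsMildSolution v0 F v →
        supPM 2 u ≤ ENNReal.ofReal (2 * ε) →
        supPM 2 v ≤ ENNReal.ofReal (2 * ε) →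
        PMnorm 2 (fun ξ => u0 ξ - v0 ξ) < ENNReal.ofReal ε →
        wsupPM a (fun ξ t => u ξ t - v ξ t) < ⊤ := by
  obtain ⟨K2, hK2, h2⟩ := ker_bound 2 le_rfl (by norm_num)
  obtain ⟨Ka, hKa, h3⟩ := ker_bound a ha ha'
  set K := K2 + Ka with hK
  have hK0 : 0 < K := by positivity
  have h2' : ∀ ξ : E3, ξ ≠ 0 → Integrable (fun z : E3 => ‖ξ - z‖ ^ (-2:ℝ) * ‖z‖ ^ (-2:ℝ)) ∧
      ∫ z : E3, ‖ξ - z‖ ^ (-2:ℝ) * ‖z‖ ^ (-2:ℝ) ≤ K * ‖ξ‖ ^ (1 - 2 : ℝ) := fun ξ hξ =>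
    ⟨(h2 ξ hξ).1, (h2 ξ hξ).2.trans (by gcongr; linarith)⟩
  have h3' : ∀ ξ : E3, ξ ≠ 0 → Integrable (fun z : E3 => ‖ξ - z‖ ^ (-2:ℝ) * ‖z‖ ^ (-a)) ∧
      ∫ z : E3, ‖ξ - z‖ ^ (-2:ℝ) * ‖z‖ ^ (-a) ≤ K * ‖ξ‖ ^ (1 - a) := fun ξ hξ =>
    ⟨(h3 ξ hξ).1, (h3 ξ hξ).2.trans (by gcongr; linarith)⟩
  refine ⟨(864 * K)⁻¹, by positivity, ?_⟩
  set ε := (864 * K)⁻¹ with hεdef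
  have hε : 0 < ε := by positivity
  have hεK : 864 * (ε * K) ≤ 1 := by rw [hεdef]; field_simp; rfl
  intro u0 v0 F u v hu hv su sv s0
  have bu : ∀ t, 0 ≤ t → ∀ᵐ ξ : E3, ‖u ξ t‖ ≤ 2 * ε * ‖ξ‖ ^ (-2:ℝ) := fun t ht =>
    pm_ae 2 (2 * ε) (by positivity) (fun ξ => u ξ t)
      ((le_iSup₂ (f := fun t (_ : 0 ≤ t) => PMnorm 2 (fun ξ => u ξ t)) t ht).trans su)
  have bv : ∀ t, 0 ≤ t → ∀ᵐ ξ : E3, ‖v ξ t‖ ≤ 2 * ε * ‖ξ‖ ^ (-2:ℝ) := fun t ht =>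
    pm_ae 2 (2 * ε) (by positivity) (fun ξ => v ξ t)
      ((le_iSup₂ (f := fun t (_ : 0 ≤ t) => PMnorm 2 (fun ξ => v ξ t)) t ht).trans sv)
  have b0 := pm_ae 2 ε hε.le _ s0.le
  have H : ∀ n : ℕ, ∀ t, 0 < t → ∀ᵐ ξ : E3, ‖u ξ t - v ξ t‖ ≤
      2 * ε * t ^ (-(a/2-1)) * ‖ξ‖ ^ (-a) + (4 * ε * (1/2) ^ n) * ‖ξ‖ ^ (-2:ℝ) := by
    intro n
    induction n with
    | zero =>
      intro t ht
      filter_upwards [bu t ht.le, bv t ht.le] with ξ h1 h2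
      have p : 0 ≤ 2 * ε * t ^ (-(a/2-1)) * ‖ξ‖ ^ (-a) := by positivity
      have := norm_sub_le (u ξ t) (v ξ t)
      rw [pow_zero]
      linarith
    | succ n ih =>
      have := step a K ε _ ha ha' hK0 hε (by positivity) hεK h2' h3' u0 v0 F u v hu hv bu bv b0 ih
      intro t ht
      filter_upwards [this t ht] with ξ h
      rw [pow_succ]
      linarith
  refine lt_of_le_of_lt (b := ENNReal.ofReal (2 * ε)) ?_ ENNReal.ofReal_lt_top
  refine iSup₂_le fun t ht => ?_
  have hfin : ∀ᵐ ξ : E3, ‖u ξ t - v ξ t‖ ≤ 2 * ε * t ^ (-(a/2-1)) * ‖ξ‖ ^ (-a) := by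
    filter_upwards [ae_all_iff.2 fun n => H n t ht] with ξ h
    have l : Tendsto (fun n : ℕ => 2 * ε * t ^ (-(a/2-1)) * ‖ξ‖ ^ (-a) +
        (4 * ε * (1/2) ^ n) * ‖ξ‖ ^ (-2:ℝ)) atTop
        (nhds (2 * ε * t ^ (-(a/2-1)) * ‖ξ‖ ^ (-a) + (4 * ε * 0) * ‖ξ‖ ^ (-2:ℝ))) :=
      (((tendsto_pow_atTop_nhds_zero_of_lt_one (by norm_num) (by norm_num)).const_mul _).mul_const
        _).const_add _
    simpa using ge_of_tendsto' l h
  refine (mul_le_mul_right (ae_pm a _ (fun ξ => u ξ t - v ξ t) hfin) _).trans ?_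
  rw [← ENNReal.ofReal_mul (by positivity)]
  apply ENNReal.ofReal_le_ofReal
  rw [Real.rpow_neg ht.le]
  have : 0 < t ^ (a/2-1) := Real.rpow_pos_of_pos ht _
  field_simp
  rfl
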